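/- arXiv:0901.1329 — 2 statements merged into one kernel-verified Lean document; each statement's English description precedes it below -/
import Mathlib

section
/- Let X be a homogeneous locally compact, locally connected metric space, and let 𝒞 be a family of subsets of X satisfying: (i) (countable closed sum) if A ⊆ X can be written as A = ⋃_{n=1}^∞ A_n where each A_n is closed in A and A_n ∈ 𝒞, then A ∈ 𝒞; (ii) (hereditarity) every subset of a member of 𝒞 that is an F_σ-set in that member belongs to 𝒞; (iii) (topological invariance) if A ∈ 𝒞 and B ⊆ X is homeomorphic to A, then B ∈ 𝒞; (iv) every compact subset K ⊆ X with K ∉ 𝒞 contains a compact subset M with M ∉ 𝒞 such that M is a Mazurkiewicz manifold with respect to the family of those subsets of M that belong to 𝒞. Then every region U of X with U ∉ 𝒞 is a Mazurkiewicz manifold with respect to the family of those subsets of U that belong to 𝒞. -/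
/-- A space is homogeneous if any point can be mapped to any other by a
self-homeomorphism. -/
def IsHomogeneous (X : Type*) [TopologicalSpace X] : Prop :=
  ∀ x y : X, ∃ h : X ≃ₜ X, h x = y

/-- A region of a topological space is a nonempty open connected subset. -/
def IsRegion {X : Type*} [TopologicalSpace X] (U : Set X) : Prop :=
  IsOpen U ∧ IsConnected U

/-- `F` is a closed subset of the subspace `Y`. -/
def ClosedIn {X : Type*} [TopologicalSpace X] (F Y : Set X) : Prop :=
  F ⊆ Y ∧ ∃ C : Set X, IsClosed C ∧ F = C ∩ Y

/-- `F` is an `F_σ`-subset of the subspace `Y`, i.e. a countable union of sets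
closed in `Y`. -/
def FSigmaIn {X : Type*} [TopologicalSpace X] (F Y : Set X) : Prop :=
  ∃ A : ℕ → Set X, (∀ n, ClosedIn (A n) Y) ∧ F = ⋃ n, A n

/-- `S` has nonempty interior in the subspace `Y`. -/
def NonemptyInteriorIn {X : Type*} [TopologicalSpace X] (S Y : Set X) : Prop :=
  ∃ O : Set X, IsOpen O ∧ (O ∩ Y).Nonempty ∧ O ∩ Y ⊆ S

/-- `Y` is a Mazurkiewicz manifold with respect to the family of those of its subsets
belonging to `𝒞`: for all disjoint subsets `Y₀, Y₁` closed in `Y` with nonempty interior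
in `Y` and every `F_σ`-subset `F` of `Y` with `F ∈ 𝒞`, some compact connected subset of
`Y \ F` meets both `Y₀` and `Y₁`. -/
def IsMazurkiewiczManifold {X : Type*} [TopologicalSpace X] (Y : Set X)
    (𝒞 : Set (Set X)) : Prop :=
  ∀ Y₀ Y₁ : Set X, ClosedIn Y₀ Y → ClosedIn Y₁ Y → Disjoint Y₀ Y₁ →
    NonemptyInteriorIn Y₀ Y → NonemptyInteriorIn Y₁ Y →
    ∀ F : Set X, FSigmaIn F Y → F ∈ 𝒞 →
      ∃ K : Set X, K ⊆ Y \ F ∧ IsCompact K ∧ IsConnected K ∧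
        (K ∩ Y₀).Nonempty ∧ (K ∩ Y₁).Nonempty

open Set Topology Filter in
theorem aux_nested {X : Type*} [MetricSpace X] (L : ℕ → Set X) (hanti : ∀ n, L (n+1) ⊆ L n)
    (hc : ∀ n, IsCompact (L n)) (hconn : ∀ n, IsConnected (L n)) :
    IsPreconnected (⋂ n, L n) := by
  have hant : Antitone L := antitone_nat_of_succ_le hanti
  have hLc : IsCompact (⋂ n, L n) :=
    (hc 0).of_isClosed_subset (isClosed_iInter fun n => (hc n).isClosed) (iInter_subset _ 0)
  intro u v hu hv huv hLu hLv
  by_contra hne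
  rw [not_nonempty_iff_eq_empty] at hne
  have h1 : IsCompact ((⋂ n, L n) \ v) := hLc.diff hv
  have h2 : IsCompact ((⋂ n, L n) \ u) := hLc.diff hu
  have hd : Disjoint ((⋂ n, L n) \ v) ((⋂ n, L n) \ u) := by
    rw [Set.disjoint_left]
    rintro x ⟨hx, hxv⟩ ⟨_, hxu⟩
    rcases huv hx with h | h <;> contradiction
  obtain ⟨u', v', hu', hv', hs1, hs2, hd'⟩ := SeparatedNhds.of_isCompact_isCompact h1 h2 hd
  have hsub : (⋂ n, L n) ⊆ u' ∪ v' := by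
    intro x hx
    by_cases hxv : x ∈ v
    · right; apply hs2; refine ⟨hx, fun hxu => ?_⟩
      have : x ∈ (⋂ n, L n) ∩ (u ∩ v) := ⟨hx, hxu, hxv⟩
      rw [hne] at this; exact this
    · left; exact hs1 ⟨hx, hxv⟩
  obtain ⟨n, hn⟩ := exists_subset_nhds_of_isCompact' (directed_of_isDirected_le hant) hc
    (fun n => (hc n).isClosed) (U := u' ∪ v') (fun x hx => (hu'.union hv').mem_nhds (hsub hx))
  obtain ⟨x, hx, hxu⟩ := hLu
  obtain ⟨y, hy, hyv⟩ := hLv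
  have hxu' : x ∈ u' := hs1 ⟨hx, fun h => by
    have : x ∈ (⋂ n, L n) ∩ (u ∩ v) := ⟨hx, hxu, h⟩
    rw [hne] at this; exact this⟩
  have hyv' : y ∈ v' := hs2 ⟨hy, fun h => by
    have : y ∈ (⋂ n, L n) ∩ (u ∩ v) := ⟨hy, h, hyv⟩
    rw [hne] at this; exact this⟩
  obtain ⟨z, _, hz1, hz2⟩ := (hconn n).isPreconnected u' v' hu' hv' hn
    ⟨x, mem_iInter.1 hx n, hxu'⟩ ⟨y, mem_iInter.1 hy n, hyv'⟩
  exact Set.disjoint_left.1 hd' hz1 hz2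

open Set Topology Filter in
theorem aux_sigma (Z : Type*) [MetricSpace Z] [LocallyCompactSpace Z] [ConnectedSpace Z] :
    SigmaCompactSpace Z := by
  have hD : ∀ x : Z, ∃ K : Set Z, IsCompact K ∧ K ∈ 𝓝 x := fun x => exists_compact_mem_nhds x
  choose K hK hKx using hD
  obtain ⟨t, hto, htU, htf, hts⟩ := precise_refinement (fun x => interior (K x))
    (fun x => isOpen_interior)
    (eq_univ_of_forall fun x => mem_iUnion.2 ⟨x, mem_interior_iff_mem_nhds.2 (hKx x)⟩)
  have hfin : ∀ i, {j | (t j ∩ t i).Nonempty}.Finite := by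
    intro i
    refine (htf.finite_nonempty_inter_compact (hK i)).subset ?_
    rintro j ⟨x, hx, hx'⟩
    exact ⟨x, hx, interior_subset (hts i hx')⟩
  obtain ⟨z⟩ : Nonempty Z := inferInstance
  obtain ⟨i0, hi0⟩ := mem_iUnion.1 (htU ▸ mem_univ z : z ∈ ⋃ i, t i)
  let I : ℕ → Set Z := fun n => Nat.rec {i0} (fun _ s => ⋃ i ∈ s, {j | (t j ∩ t i).Nonempty}) n
  have hI : ∀ n, (I n).Finite := by
    intro n
    induction n with
    | zero => exact finite_singleton _
    | succ n ih => exact ih.biUnion fun i _ => hfin i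
  have hC : IsClopen (⋃ n, ⋃ i ∈ I n, t i) := by
    refine ⟨?_, isOpen_iUnion fun n => isOpen_biUnion fun i _ => hto i⟩
    rw [← isOpen_compl_iff, isOpen_iff_mem_nhds]
    intro x hx
    obtain ⟨j, hj⟩ := mem_iUnion.1 (htU ▸ mem_univ x : x ∈ ⋃ i, t i)
    refine mem_of_superset ((hto j).mem_nhds hj) ?_
    intro y hy hyC
    apply hx
    simp only [mem_iUnion] at hyC ⊢
    obtain ⟨n, i, hi, hyi⟩ := hyC
    refine ⟨n+1, j, ?_, hj⟩
    exact mem_biUnion hi ⟨y, hy, hyi⟩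
  have huniv := hC.eq_univ ⟨z, mem_iUnion.2 ⟨0, mem_biUnion (mem_singleton i0) hi0⟩⟩
  refine SigmaCompactSpace_iff_exists_compact_covering.2
    ⟨fun n => ⋃ i ∈ I n, K i, fun n => (hI n).isCompact_biUnion fun i _ => hK i, ?_⟩
  rw [eq_univ_iff_forall] at huniv ⊢
  intro x
  have := huniv x
  simp only [mem_iUnion] at this ⊢
  obtain ⟨n, i, hi, hx⟩ := this
  exact ⟨n, i, hi, interior_subset (hts i hx)⟩

open Set Topology Filter TopologicalSpace in
theorem aux_effros (Z : Type*) [MetricSpace Z] [LocallyCompactSpace Z] [SecondCountableTopology Z]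
    (c a : Z) (g : Z → (Z ≃ₜ Z)) (hg : ∀ y, g y c = y) (P V A B : Set Z)
    (hP : IsCompact P) (hV : IsOpen V) (hPV : P ⊆ V) (hA : IsOpen A) (ha : a ∈ A)
    (hB : IsOpen B) (hc : c ∈ closure B) :
    ∃ y y', (∀ x ∈ P, (g y).symm (g y' x) ∈ V) ∧ (g y).symm (g y' a) ∈ A ∧
      (g y).symm (g y' c) ∈ B := by
  let T := C(Z, Z) × C(Z, Z)
  let t : Z → T := fun y => (⟨g y, (g y).continuous⟩, ⟨(g y).symm, (g y).symm.continuous⟩)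
  let N : Set C(Z, Z) := {f | MapsTo f P V} ∩ {f | f a ∈ A}
  have hN : IsOpen N := (ContinuousMap.isOpen_setOfPred_mapsTo hP hV).inter
    (hA.preimage (ContinuousEvalConst.continuous_eval_const a))
  have hphi : Continuous (fun p : T × T => p.1.2.comp p.2.1) :=
    ContinuousMap.continuous_comp'.comp
      ((continuous_fst.comp continuous_snd).prodMk (continuous_snd.comp continuous_fst))
  have hW : ∀ y, ∃ W : countableBasis T, t y ∈ W.1 ∧
      ∀ p ∈ W.1, ∀ q ∈ W.1, p.2.comp q.1 ∈ N := by
    intro y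
    have hmem : (t y, t y) ∈ (fun p : T × T => p.1.2.comp p.2.1) ⁻¹' N := by
      constructor
      · intro x hx
        simpa [t] using hPV hx
      · simpa [t] using ha
    have := (hN.preimage hphi).mem_nhds hmem
    rw [nhds_prod_eq, mem_prod_self_iff] at this
    obtain ⟨s, hs, hss⟩ := this
    obtain ⟨W, hWb, hyW, hWs⟩ := (isBasis_countableBasis T).mem_nhds_iff.1 hs
    exact ⟨⟨W, hWb⟩, hyW, fun p hp q hq => hss (mk_mem_prod (hWs hp) (hWs hq))⟩
  choose W hW1 hW2 using hW
  have : Countable (countableBasis T) := (countable_countableBasis T).to_subtype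
  have : Nonempty Z := ⟨c⟩
  obtain ⟨w, hw⟩ := nonempty_interior_of_iUnion_of_closed
    (f := fun w : countableBasis T => closure {y | W y = w}) (fun _ => isClosed_closure)
    (eq_univ_of_forall fun y => mem_iUnion.2 ⟨W y, subset_closure rfl⟩)
  obtain ⟨y0, hy0⟩ := hw
  obtain ⟨y, hyI, hyw⟩ := mem_closure_iff.1 (interior_subset hy0) _ isOpen_interior hy0
  have hycl : y ∈ closure (g y '' B) := by
    have := image_closure_subset_closure_image (g y).continuous (mem_image_of_mem (g y) hc)
    rwa [hg] at this
  obtain ⟨y1, hy1I, hy1B⟩ := mem_closure_iff.1 hycl _ isOpen_interior hyI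
  obtain ⟨y', hy'1, hy'w⟩ := mem_closure_iff.1 (interior_subset hy1I) _
    ((g y).isOpenMap B hB) hy1B
  have hm := hW2 y (t y) (hW1 y) (t y') (by
    have : W y = W y' := by rw [show W y = w from hyw, show W y' = w from hy'w]
    rw [this]; exact hW1 y')
  refine ⟨y, y', fun x hx => hm.1 hx, hm.2, ?_⟩
  obtain ⟨b, hb, hby⟩ := hy'1
  rw [hg, ← hby]
  simpa using hb

open Set Topology Filter TopologicalSpace in
theorem aux_effros' {X : Type*} [MetricSpace X] [LocallyCompactSpace X] [LocallyConnectedSpace X]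
    (hhom : IsHomogeneous X) (c a : X) (P V A B : Set X)
    (hP : IsCompact P) (hV : IsOpen V) (hPV : P ⊆ V) (hVc : IsPreconnected V) (hcV : c ∈ V)
    (hA : IsOpen A) (ha : a ∈ A) (haP : a ∈ P)
    (hB : IsOpen B) (hc : c ∈ closure B) :
    ∃ k : X ≃ₜ X, (∀ x ∈ P, k x ∈ V) ∧ k a ∈ A ∧ k c ∈ B := by
  let Z : Set X := connectedComponent c
  have hZo : IsOpen Z := isOpen_connectedComponent
  have hVZ : V ⊆ Z := hVc.subset_connectedComponent hcV
  have : ConnectedSpace Z := isConnected_iff_connectedSpace.1 isConnected_connectedComponent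
  have : LocallyCompactSpace Z := hZo.locallyCompactSpace
  have := aux_sigma Z
  have : SecondCountableTopology Z := inferInstance
  choose G hG using hhom c
  have hGZ : ∀ y ∈ Z, ∀ x, x ∈ Z ↔ G y x ∈ Z := by
    intro y hy x
    have himg : G y '' Z = Z := by
      have h1 : G y '' connectedComponent c = connectedComponent (G y c) := by
        apply subset_antisymm
        · exact (G y).continuous.image_connectedComponent_subset c
        · have := (G y).symm.continuous.image_connectedComponent_subset (G y c)
          rw [Homeomorph.symm_apply_apply] at this
          intro z hz
          exact ⟨(G y).symm z, this (mem_image_of_mem _ hz), by simp⟩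
      rw [hG] at h1
      rw [show G y '' Z = _ from h1]
      exact (connectedComponent_eq hy).symm
    constructor
    · intro hx; rw [← himg]; exact mem_image_of_mem _ hx
    · intro hx; rw [← himg] at hx
      obtain ⟨x', hx', he⟩ := hx
      rwa [← (G y).injective he]
  let g : Z → (Z ≃ₜ Z) := fun y => (G y).subtype (hGZ y y.2)
  have hgs : ∀ (y x : Z), (((g y).symm x : Z) : X) = (G y).symm x := by
    intro y x
    rw [Homeomorph.eq_symm_apply]
    change ((g y ((g y).symm x) : Z) : X) = x
    rw [Homeomorph.apply_symm_apply]
  obtain ⟨y, y', h1, h2, h3⟩ := aux_effros Z ⟨c, mem_connectedComponent⟩ ⟨a, hVZ (hPV haP)⟩ g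
    (fun y => Subtype.ext (hG y)) (Subtype.val ⁻¹' P) (Subtype.val ⁻¹' V) (Subtype.val ⁻¹' A)
    (Subtype.val ⁻¹' B)
    (IsInducing.subtypeVal.isCompact_preimage' hP (by
      rw [Subtype.range_coe]; exact hPV.trans hVZ))
    (hV.preimage continuous_subtype_val) (preimage_mono hPV)
    (hA.preimage continuous_subtype_val) ha (hB.preimage continuous_subtype_val)
    (by
      rw [mem_closure_iff] at hc ⊢
      intro o ho hco
      obtain ⟨b, hb, hbB⟩ := hc (Subtype.val '' o) (hZo.isOpenMap_subtype_val o ho) ⟨_, hco, rfl⟩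
      obtain ⟨b', hb', rfl⟩ := hb
      exact ⟨b', hb', hbB⟩)
  simp only [mem_preimage, hgs] at h1 h2 h3
  refine ⟨(G y').trans (G y).symm, ?_, h2, h3⟩
  intro x hx
  exact h1 ⟨x, hVZ (hPV hx)⟩ hx

open Set Topology Filter TopologicalSpace in
theorem aux_chain {X : Type*} [MetricSpace X] [LocallyCompactSpace X] [LocallyConnectedSpace X]
    (W : Set X) (hW : IsOpen W) (hWc : IsPreconnected W) (x y : X) (hx : x ∈ W) (hy : y ∈ W) :
    ∃ V, IsOpen V ∧ IsConnected V ∧ x ∈ V ∧ y ∈ V ∧ IsCompact (closure V) ∧ closure V ⊆ W := by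
  refine hWc.induction₂' (fun x y => ∃ V, IsOpen V ∧ IsConnected V ∧ x ∈ V ∧ y ∈ V ∧
    IsCompact (closure V) ∧ closure V ⊆ W) ?_ ?_ hx hy
  · intro x hx
    obtain ⟨K, hK, hxK, hKW⟩ := exists_compact_subset hW hx
    obtain ⟨V, hVK, hV, hxV, hVc⟩ :=
      locallyConnectedSpace_iff_subsets_isOpen_isConnected.1 ‹_› x _ (isOpen_interior.mem_nhds hxK)
    have hcl : closure V ⊆ K := closure_minimal (hVK.trans interior_subset) hK.isClosed
    filter_upwards [mem_nhdsWithin_of_mem_nhds (hV.mem_nhds hxV)] with z hz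
    exact ⟨⟨V, hV, hVc, hxV, hz, hK.of_isClosed_subset isClosed_closure hcl, hcl.trans hKW⟩,
      ⟨V, hV, hVc, hz, hxV, hK.of_isClosed_subset isClosed_closure hcl, hcl.trans hKW⟩⟩
  · rintro x y z - - - ⟨V, h1, h2, h3, h4, h5, h6⟩ ⟨V', h1', h2', h3', h4', h5', h6'⟩
    refine ⟨V ∪ V', h1.union h1', h2.union ⟨y, h4, h3'⟩ h2', Or.inl h3, Or.inr h4', ?_, ?_⟩
    · rw [closure_union]; exact h5.union h5'
    · rw [closure_union]; exact union_subset h6 h6'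

theorem aux_closed_mem {X : Type*} [MetricSpace X] {𝒞 : Set (Set X)}
    (hher : ∀ A ∈ 𝒞, ∀ B : Set X, FSigmaIn B A → B ∈ 𝒞) {F C : Set X} (hF : F ∈ 𝒞)
    (hC : IsClosed C) : C ∩ F ∈ 𝒞 :=
  hher F hF _ ⟨fun _ => C ∩ F, fun _ => ⟨Set.inter_subset_right, C, hC, rfl⟩,
    (Set.iUnion_const _).symm⟩

open Set Topology Filter in
theorem aux_pieces {X : Type*} [MetricSpace X] {𝒞 : Set (Set X)}
    (hsum : ∀ (A : Set X) (An : ℕ → Set X),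
      (∀ n, ClosedIn (An n) A) → (∀ n, An n ∈ 𝒞) → A = ⋃ n, An n → A ∈ 𝒞)
    (h0 : ∅ ∈ 𝒞) {M : Set X} (hM : IsCompact M) (hMC : M ∉ 𝒞) {r : ℝ} (hr : 0 < r) :
    ∃ x, M ∩ Metric.closedBall x r ∉ 𝒞 := by
  by_contra! hcon
  obtain ⟨t, htM, htf, hcov⟩ := hM.finite_cover_balls hr
  rcases t.eq_empty_or_nonempty with rfl | hne
  · apply hMC
    have : M = ∅ := by simpa using hcov
    rwa [this]
  · obtain ⟨f, rfl⟩ := htf.countable.exists_eq_range hne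
    refine hMC (hsum M (fun n => M ∩ Metric.closedBall (f n) r)
      (fun n => ⟨inter_subset_left, _, Metric.isClosed_closedBall, inter_comm _ _⟩)
      (fun n => hcon _) ?_)
    rw [← inter_iUnion]
    refine (inter_eq_left.2 fun x hx => ?_).symm
    have := hcov hx
    simp only [mem_iUnion, mem_range] at this
    obtain ⟨_, ⟨n, rfl⟩, hn⟩ := this
    exact mem_iUnion.2 ⟨n, Metric.ball_subset_closedBall hn⟩

open Set Topology Filter in
theorem aux_point {X : Type*} [MetricSpace X] {𝒞 : Set (Set X)}
    (hsum : ∀ (A : Set X) (An : ℕ → Set X),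
      (∀ n, ClosedIn (An n) A) → (∀ n, An n ∈ 𝒞) → A = ⋃ n, An n → A ∈ 𝒞)
    (hmaz : ∀ K : Set X, IsCompact K → K ∉ 𝒞 →
      ∃ M : Set X, M ⊆ K ∧ IsCompact M ∧ M ∉ 𝒞 ∧ IsMazurkiewiczManifold M 𝒞)
    (h0 : ∅ ∈ 𝒞) {K : Set X} (hK : IsCompact K) (hKC : K ∉ 𝒞) :
    ∃ m : X, ∀ O ∈ 𝓝 m, ∃ M, M ⊆ O ∧ IsCompact M ∧ M ∉ 𝒞 ∧ IsMazurkiewiczManifold M 𝒞 ∧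
      m ∈ M := by
  let S := {M : Set X // IsCompact M ∧ M ∉ 𝒞 ∧ IsMazurkiewiczManifold M 𝒞}
  have hstep : ∀ (n : ℕ) (M : S), ∃ M' : S, M'.1 ⊆ M.1 ∧
      ∃ x, M'.1 ⊆ Metric.closedBall x (1 / ((n : ℝ) + 1)) := by
    rintro n ⟨M, hM, hMC, hMm⟩
    obtain ⟨x, hx⟩ := aux_pieces hsum h0 hM hMC (r := 1 / ((n : ℝ) + 1)) (by positivity)
    obtain ⟨M', h1, h2, h3, h4⟩ := hmaz _ (hM.inter_right Metric.isClosed_closedBall) hx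
    exact ⟨⟨M', h2, h3, h4⟩, h1.trans inter_subset_left, x, h1.trans inter_subset_right⟩
  choose nxt hn1 hn2 using hstep
  obtain ⟨M0, _, h1, h2, h3⟩ := hmaz K hK hKC
  let Ms : ℕ → S := fun n => Nat.rec ⟨M0, h1, h2, h3⟩ nxt n
  have hsucc : ∀ n, Ms (n+1) = nxt n (Ms n) := fun n => rfl
  have hne : (⋂ n, (Ms n).1).Nonempty := by
    refine IsCompact.nonempty_iInter_of_sequence_nonempty_isCompact_isClosed _
      (fun n => ?_) (fun n => ?_) (Ms 0).2.1 (fun n => (Ms n).2.1.isClosed)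
    · rw [hsucc]; exact hn1 _ _
    · rw [nonempty_iff_ne_empty]
      intro h
      exact (Ms n).2.2.1 (h ▸ h0)
  obtain ⟨m, hm⟩ := hne
  rw [mem_iInter] at hm
  refine ⟨m, fun O hO => ?_⟩
  obtain ⟨ε, hε, hεO⟩ := Metric.mem_nhds_iff.1 hO
  obtain ⟨n, hn⟩ := exists_nat_one_div_lt (half_pos hε)
  refine ⟨(Ms (n+1)).1, ?_, (Ms (n+1)).2.1, (Ms (n+1)).2.2.1, (Ms (n+1)).2.2.2, hm (n+1)⟩
  obtain ⟨x, hx⟩ := hn2 n (Ms n)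
  rw [← hsucc] at hx
  intro z hz
  apply hεO
  have a1 := Metric.mem_closedBall.1 (hx hz)
  have a2 := Metric.mem_closedBall.1 (hx (hm (n+1)))
  rw [Metric.mem_ball]
  linarith [dist_triangle_right z m x]

open Set Topology Filter in
theorem aux_ball {X : Type*} [MetricSpace X] {M O : Set X} {a : X} (ha : a ∈ M) (hO : IsOpen O)
    (haO : a ∈ O) : ∃ Y, Y ⊆ O ∧ ClosedIn Y M ∧ NonemptyInteriorIn Y M := by
  obtain ⟨ε, hε, hεO⟩ := Metric.nhds_basis_closedBall.mem_iff.1 (hO.mem_nhds haO)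
  refine ⟨Metric.closedBall a ε ∩ M, inter_subset_left.trans hεO,
    ⟨inter_subset_right, _, Metric.isClosed_closedBall, rfl⟩,
    Metric.ball a ε, Metric.isOpen_ball, ⟨a, Metric.mem_ball_self hε, ha⟩,
    inter_subset_inter_left _ Metric.ball_subset_closedBall⟩

open Set Topology Filter in
/-- A copy of a Mazurkiewicz manifold cannot be separated by a closed member of the family. -/
theorem aux_key {X : Type*} [MetricSpace X] {𝒞 : Set (Set X)}
    (hher : ∀ A ∈ 𝒞, ∀ B : Set X, FSigmaIn B A → B ∈ 𝒞)
    (hinv : ∀ A ∈ 𝒞, ∀ B : Set X, Nonempty (A ≃ₜ B) → B ∈ 𝒞)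
    {V F A B M : Set X} (hFV : ClosedIn F V) (hF : F ∈ 𝒞) (hA : IsOpen A) (hB : IsOpen B)
    (hAB : Disjoint A B) (hVAB : V \ F ⊆ A ∪ B) (hM : IsCompact M)
    (hMm : IsMazurkiewiczManifold M 𝒞) (f : X ≃ₜ X) (hfM : ∀ x ∈ M, f x ∈ V)
    {a b : X} (ha : a ∈ M) (hb : b ∈ M) (haA : f a ∈ A) (hbB : f b ∈ B) : False := by
  obtain ⟨hFsub, C, hC, hFC⟩ := hFV
  obtain ⟨Y0, hY0, hY0c, hY0i⟩ := aux_ball ha (hA.preimage f.continuous) haA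
  obtain ⟨Y1, hY1, hY1c, hY1i⟩ := aux_ball hb (hB.preimage f.continuous) hbB
  have hF1 : f '' M ∩ F ∈ 𝒞 := aux_closed_mem hher hF (hM.image f.continuous).isClosed
  have hF2 : f.symm '' (f '' M ∩ F) ∈ 𝒞 := hinv _ hF1 _ ⟨f.symm.image _⟩
  have hF3 : f.symm '' (f '' M ∩ F) = (f ⁻¹' C) ∩ M := by
    ext x
    rw [f.symm.image_eq_preimage_symm]
    simp only [Homeomorph.symm_symm, mem_preimage, mem_inter_iff, f.injective.mem_set_image]
    rw [hFC]
    constructor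
    · rintro ⟨h1, h2, _⟩; exact ⟨h2, h1⟩
    · rintro ⟨h1, h2⟩; exact ⟨h2, h1, hfM x h2⟩
  rw [hF3] at hF2
  obtain ⟨K, hKM, _, hKc, ⟨p, hpK, hp⟩, ⟨q, hqK, hq⟩⟩ := hMm Y0 Y1 hY0c hY1c
    ((hAB.preimage f).mono hY0 hY1) hY0i hY1i _
    ⟨fun _ => (f ⁻¹' C) ∩ M, fun _ => ⟨inter_subset_right, _, hC.preimage f.continuous, rfl⟩,
      (iUnion_const _).symm⟩ hF2
  obtain ⟨z, _, hz1, hz2⟩ := hKc.isPreconnected (f ⁻¹' A) (f ⁻¹' B) (hA.preimage f.continuous)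
    (hB.preimage f.continuous) (by
      intro x hx
      obtain ⟨h1, h2⟩ := hKM hx
      exact hVAB ⟨hfM x h1, fun h => h2 ⟨by rw [hFC] at h; exact h.1, h1⟩⟩)
    ⟨p, hpK, hY0 hp⟩ ⟨q, hqK, hY1 hq⟩
  exact Set.disjoint_left.1 hAB hz1 hz2

open Set Topology Filter in
theorem aux_compact_mem {X : Type*} [MetricSpace X] {𝒞 : Set (Set X)}
    (hher : ∀ A ∈ 𝒞, ∀ B : Set X, FSigmaIn B A → B ∈ 𝒞)
    (hinv : ∀ A ∈ 𝒞, ∀ B : Set X, Nonempty (A ≃ₜ B) → B ∈ 𝒞)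
    {F M : Set X} (hF : F ∈ 𝒞) (hM : IsCompact M) (hMC : M ∉ 𝒞) (f : X ≃ₜ X) :
    ∃ x ∈ M, f x ∉ F := by
  by_contra! h
  have h1 : f '' M ∩ F ∈ 𝒞 := aux_closed_mem hher hF (hM.image f.continuous).isClosed
  rw [inter_eq_left.2 (image_subset_iff.2 h)] at h1
  exact hMC (hinv _ h1 _ ⟨(f.image M).symm⟩)

open Set Topology Filter in
/-- Regions are not separated by closed members of the family. -/
theorem aux_diff {X : Type*} [MetricSpace X] [LocallyCompactSpace X] [LocallyConnectedSpace X]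
    (hhom : IsHomogeneous X) {𝒞 : Set (Set X)}
    (hher : ∀ A ∈ 𝒞, ∀ B : Set X, FSigmaIn B A → B ∈ 𝒞)
    (hinv : ∀ A ∈ 𝒞, ∀ B : Set X, Nonempty (A ≃ₜ B) → B ∈ 𝒞)
    {m : X} (hm : ∀ O ∈ 𝓝 m, ∃ M, M ⊆ O ∧ IsCompact M ∧ M ∉ 𝒞 ∧ IsMazurkiewiczManifold M 𝒞 ∧
      m ∈ M)
    {V F : Set X} (hV : IsOpen V) (hVc : IsPreconnected V) (hFV : ClosedIn F V) (hF : F ∈ 𝒞) :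
    IsOpen (V \ F) ∧ IsPreconnected (V \ F) ∧
      ∀ O, IsOpen O → (O ∩ V).Nonempty → (O ∩ (V \ F)).Nonempty := by
  have hopen : IsOpen (V \ F) := by
    obtain ⟨_, C, hC, rfl⟩ := hFV
    have : V \ (C ∩ V) = V \ C := by ext; simp
    rw [this]
    exact hV.sdiff hC
  have hdense : ∀ O, IsOpen O → (O ∩ V).Nonempty → (O ∩ (V \ F)).Nonempty := by
    rintro O hO ⟨c, hcO, hcV⟩
    obtain ⟨f, hf⟩ := hhom m c
    obtain ⟨M, hMO, hM, hMC, -, -⟩ := hm (f ⁻¹' (O ∩ V))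
      (((hO.inter hV).preimage f.continuous).mem_nhds (by simp [hf, hcO, hcV]))
    obtain ⟨x, hx, hxF⟩ := aux_compact_mem hher hinv hF hM hMC f
    exact ⟨f x, (hMO hx).1, (hMO hx).2, hxF⟩
  refine ⟨hopen, ?_, hdense⟩
  intro u v hu hv huv hu1 hv1
  by_contra hne
  rw [not_nonempty_iff_eq_empty] at hne
  -- the asymmetric step
  have main : ∀ A B : Set X, IsOpen A → IsOpen B → Disjoint A B → V \ F ⊆ A ∪ B →
      ∀ c ∈ V, c ∈ closure B → ∀ f : X ≃ₜ X, f m = c → ∀ M, IsCompact M →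
      IsMazurkiewiczManifold M 𝒞 → m ∈ M → (∀ x ∈ M, f x ∈ V) → ∀ x ∈ M, f x ∈ A → False := by
    intro A B hA hB hAB hcov c hcV hcB f hfm M hM hMm hmM hfM x hxM hxA
    obtain ⟨k, hk1, hk2, hk3⟩ := aux_effros' hhom c (f x) (f '' M) V A B (hM.image f.continuous)
      hV (image_subset_iff.2 hfM) hVc hcV hA hxA (mem_image_of_mem _ hxM) hB hcB
    exact aux_key hher hinv hFV hF hA hB hAB hcov hM hMm (f.trans k)
      (fun z hz => hk1 _ (mem_image_of_mem _ hz)) hxM hmM hk2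
      (by rw [Homeomorph.trans_apply, hfm]; exact hk3)
  have hA : IsOpen ((V \ F) ∩ u) := hopen.inter hu
  have hB : IsOpen ((V \ F) ∩ v) := hopen.inter hv
  have hAB : Disjoint ((V \ F) ∩ u) ((V \ F) ∩ v) := by
    rw [disjoint_iff_inter_eq_empty, ← inter_inter_distrib_left]; exact hne
  have hcov : V \ F ⊆ ((V \ F) ∩ u) ∪ ((V \ F) ∩ v) := by
    rw [← inter_union_distrib_left]; exact subset_inter le_rfl huv
  obtain ⟨c, hcV, hcA, hcB⟩ := isPreconnected_closed_iff.1 hVc _ _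
    (isClosed_closure (s := (V \ F) ∩ u)) (isClosed_closure (s := (V \ F) ∩ v)) (by
      intro x hx
      rw [← closure_union]
      refine closure_mono hcov (mem_closure_iff.2 fun O hO hxO => hdense O hO ⟨x, hxO, hx⟩))
    (hu1.mono fun x hx => ⟨hx.1.1, subset_closure hx⟩)
    (hv1.mono fun x hx => ⟨hx.1.1, subset_closure hx⟩)
  obtain ⟨f, hf⟩ := hhom m c
  obtain ⟨M, hMV, hM, hMC, hMm, hmM⟩ := hm (f ⁻¹' V)
    ((hV.preimage f.continuous).mem_nhds (by simp [hf, hcV]))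
  obtain ⟨x, hx, hxF⟩ := aux_compact_mem hher hinv hF hM hMC f
  rcases hcov ⟨hMV hx, hxF⟩ with h | h
  · exact main _ _ hA hB hAB hcov c hcV hcB f hf M hM hMm hmM hMV x hx h
  · exact main _ _ hB hA hAB.symm (by rwa [union_comm]) c hcV hcA f hf M hM hMm hmM hMV x hx h

theorem region_is_mazurkiewicz_manifold
    {X : Type*} [MetricSpace X] [LocallyCompactSpace X] [LocallyConnectedSpace X]
    (hhom : IsHomogeneous X) (𝒞 : Set (Set X))
    (hsum : ∀ (A : Set X) (An : ℕ → Set X),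
      (∀ n, ClosedIn (An n) A) → (∀ n, An n ∈ 𝒞) → A = ⋃ n, An n → A ∈ 𝒞)
    (hher : ∀ A ∈ 𝒞, ∀ B : Set X, FSigmaIn B A → B ∈ 𝒞)
    (hinv : ∀ A ∈ 𝒞, ∀ B : Set X, Nonempty (A ≃ₜ B) → B ∈ 𝒞)
    (hmaz : ∀ K : Set X, IsCompact K → K ∉ 𝒞 →
      ∃ M : Set X, M ⊆ K ∧ IsCompact M ∧ M ∉ 𝒞 ∧ IsMazurkiewiczManifold M 𝒞)
    (U : Set X) (hU : IsRegion U) (hUC : U ∉ 𝒞) :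
    IsMazurkiewiczManifold U 𝒞 := by
  intro Y0 Y1 hY0 hY1 hdisj hI0 hI1 F hFU hF
  have h0 : (∅ : Set X) ∈ 𝒞 := by
    have := aux_closed_mem hher hF isClosed_empty
    rwa [Set.empty_inter] at this
  obtain ⟨hUo, hUc⟩ := hU
  -- a compact set outside the family
  have hK : ∃ K : Set X, IsCompact K ∧ K ∉ 𝒞 := by
    by_contra! hcon
    have : ConnectedSpace U := isConnected_iff_connectedSpace.1 hUc
    have : LocallyCompactSpace U := hUo.locallyCompactSpace
    have := aux_sigma U
    have hc : ∀ n, IsCompact ((Subtype.val : U → X) '' compactCovering U n) := fun n =>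
      (isCompact_compactCovering U n).image continuous_subtype_val
    refine hUC (hsum U (fun n => Subtype.val '' compactCovering U n)
      (fun n => ⟨Subtype.coe_image_subset _ _, _, (hc n).isClosed,
        (Set.inter_eq_left.2 (Subtype.coe_image_subset _ _)).symm⟩) (fun n => hcon _ (hc n)) ?_)
    rw [← Set.image_iUnion, iUnion_compactCovering, Set.image_univ, Subtype.range_coe]
  obtain ⟨K, hK, hKC⟩ := hK
  obtain ⟨m, hm⟩ := aux_point hsum hmaz h0 hK hKC
  obtain ⟨O0, hO0, hO0n, hO0s⟩ := hI0
  obtain ⟨O1, hO1, hO1n, hO1s⟩ := hI1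
  obtain ⟨Fn, hFn, rfl⟩ := hFU
  let S := {V : Set X // IsOpen V ∧ IsConnected V ∧ V ⊆ U ∧ (O0 ∩ V).Nonempty ∧ (O1 ∩ V).Nonempty}
  have hstep : ∀ (n : ℕ) (V : S), ∃ V' : S, IsCompact (closure V'.1) ∧
      closure V'.1 ⊆ V.1 \ Fn n := by
    rintro n ⟨V, hV, hVc, hVU, hV0, hV1⟩
    obtain ⟨hsubn, C, hC, hCn⟩ := hFn n
    have hFnV : C ∩ V = Fn n ∩ V := by
      rw [hCn, Set.inter_assoc, Set.inter_eq_right.2 hVU]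
    have hmem : C ∩ V ∈ 𝒞 := by
      refine hher _ hF _ ?_
      have hVs : ∃ D : ℕ → Set X, (∀ k, IsClosed (D k)) ∧ ⋃ k, D k = V := by
        obtain ⟨D, h1, _, h3, _⟩ := hV.exists_iUnion_isClosed
        exact ⟨D, h1, h3⟩
      obtain ⟨D, hD, hDV⟩ := hVs
      refine ⟨fun k => (C ∩ D k) ∩ ⋃ n, Fn n, fun k => ⟨Set.inter_subset_right, _,
        hC.inter (hD k), rfl⟩, ?_⟩
      rw [← Set.iUnion_inter, ← Set.inter_iUnion, hDV]
      refine (Set.inter_eq_left.2 ?_).symm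
      rw [hFnV]
      exact Set.inter_subset_left.trans (Set.subset_iUnion Fn n)
    obtain ⟨hW, hWc, hWd⟩ := aux_diff hhom hher hinv hm hV hVc.isPreconnected
      (F := C ∩ V) ⟨Set.inter_subset_right, C, hC, rfl⟩ hmem
    obtain ⟨x, hx0, hxW⟩ := hWd O0 hO0 hV0
    obtain ⟨y, hy1, hyW⟩ := hWd O1 hO1 hV1
    obtain ⟨V', g1, g2, g3, g4, g5, g6⟩ := aux_chain _ hW hWc x y hxW hyW
    refine ⟨⟨V', g1, g2, ?_, ⟨x, hx0, g3⟩, ⟨y, hy1, g4⟩⟩, g5, ?_⟩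
    · exact (subset_closure.trans g6).trans (Set.sdiff_subset.trans hVU)
    · intro z hz
      obtain ⟨q1, q2⟩ := g6 hz
      refine ⟨q1, fun h => q2 ?_⟩
      rw [hFnV]
      exact ⟨h, q1⟩
  choose nxt hn1 hn2 using hstep
  let Vs : ℕ → S := fun n => Nat.rec ⟨U, hUo, hUc, le_rfl, hO0n, hO1n⟩ nxt n
  have hsucc : ∀ n, Vs (n+1) = nxt n (Vs n) := fun n => rfl
  let L : ℕ → Set X := fun n => closure (Vs (n+1)).1
  have hLc : ∀ n, IsCompact (L n) := fun n => by
    change IsCompact (closure (Vs (n+1)).1); rw [hsucc]; exact hn1 _ _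
  have hLs : ∀ n, L n ⊆ (Vs n).1 \ Fn n := fun n => by
    change closure (Vs (n+1)).1 ⊆ _; rw [hsucc]; exact hn2 _ _
  have hLanti : ∀ n, L (n+1) ⊆ L n := fun n =>
    (hLs (n+1)).trans (Set.sdiff_subset.trans subset_closure)
  have hLconn : ∀ n, IsConnected (L n) := fun n => (Vs (n+1)).2.2.1.closure
  have hmeet : ∀ (Y O : Set X), ClosedIn Y U → O ∩ U ⊆ Y → (∀ n, (O ∩ (Vs n).1).Nonempty) →
      ((⋂ n, L n) ∩ Y).Nonempty := by
    rintro Y O ⟨_, C, hC, rfl⟩ hOY hO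
    have : (⋂ n, (L n ∩ C)).Nonempty := by
      refine IsCompact.nonempty_iInter_of_sequence_nonempty_isCompact_isClosed _
        (fun n => Set.inter_subset_inter_left _ (hLanti n)) (fun n => ?_) ((hLc 0).inter_right hC)
        (fun n => (hLc n).isClosed.inter hC)
      obtain ⟨x, hx, hx'⟩ := hO (n+1)
      exact ⟨x, subset_closure hx', (hOY ⟨hx, (Vs (n+1)).2.2.2.1 hx'⟩).1⟩
    obtain ⟨x, hx⟩ := this
    rw [Set.mem_iInter] at hx
    exact ⟨x, Set.mem_iInter.2 fun n => (hx n).1, (hx 0).2, (hLs 0 (hx 0).1).1⟩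
  have hm0 := hmeet Y0 O0 hY0 hO0s fun n => (Vs n).2.2.2.2.1
  have hm1 := hmeet Y1 O1 hY1 hO1s fun n => (Vs n).2.2.2.2.2
  refine ⟨⋂ n, L n, ?_, (hLc 0).of_isClosed_subset
    (isClosed_iInter fun n => (hLc n).isClosed) (Set.iInter_subset _ 0),
    ⟨hm0.mono Set.inter_subset_left, aux_nested L hLanti hLc hLconn⟩, hm0, hm1⟩
  intro x hx
  rw [Set.mem_iInter] at hx
  refine ⟨(hLs 0 (hx 0)).1, fun h => ?_⟩
  obtain ⟨n, hn⟩ := Set.mem_iUnion.1 h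
  exact (hLs n (hx n)).2 hn
end

section
/- Let X be a homogeneous locally compact metric space with metric ρ, let K ⊆ X be compact, let W ⊆ X be open with K ⊆ W, and let p ∈ K. Then there exists δ > 0 such that for every q ∈ X with ρ(p, q) < δ there is a homeomorphism h : X → X with h(p) = q and h(K) ⊆ W. -/
open Set Filter Topology Pointwise TopologicalSpace

/-! ### An abstract Effros-type theorem for Polish groups -/

/-- Near-openness of the orbit maps, by Baire category. -/
theorem effros_closure_mem_nhds {G Y : Type*} [Group G] [TopologicalSpace G]
    [IsTopologicalGroup G] [SecondCountableTopology G] [TopologicalSpace Y] [BaireSpace Y]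
    [MulAction G Y] [ContinuousSMul G Y] [MulAction.IsPretransitive G Y]
    {U : Set G} (hU : U ∈ 𝓝 (1 : G)) (x : Y) : closure (U • ({x} : Set Y)) ∈ 𝓝 x := by
  obtain ⟨V, V_mem, V_closed, V_symm, VU⟩ : ∃ V ∈ 𝓝 (1 : G), IsClosed V ∧ V⁻¹ = V ∧ V * V ⊆ U :=
    exists_closed_nhds_one_inv_eq_mul_subset hU
  obtain ⟨s, s_count, hs⟩ : ∃ (s : Set G), s.Countable ∧ ⋃ g ∈ s, g • V = univ :=
    TopologicalSpace.countable_cover_nhds fun _ ↦ by simpa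
  let F : s → Set Y := fun g ↦ closure (((g : G) • V) • ({x} : Set Y))
  obtain ⟨⟨g, hg⟩, I⟩ : ∃ i, (interior (F i)).Nonempty := by
    have : Nonempty Y := ⟨x⟩
    have : Countable s := s_count
    apply nonempty_interior_of_iUnion_of_closed
    · intro i
      exact isClosed_closure
    · apply eq_univ_iff_forall.2 (fun y ↦ ?_)
      obtain ⟨h, rfl⟩ : ∃ h : G, h • x = y := MulAction.exists_smul_eq G x y
      obtain ⟨g, gs, hg⟩ : ∃ g ∈ s, h ∈ g • V := exists_set_mem_of_union_eq_top s _ hs _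
      refine mem_iUnion.2 ⟨⟨g, gs⟩, subset_closure ?_⟩
      exact smul_mem_smul hg (mem_singleton x)
  obtain ⟨y, hy⟩ : (interior (closure (V • ({x} : Set Y)))).Nonempty := by
    simp only [F] at I
    rw [smul_assoc, closure_smul, interior_smul] at I
    exact smul_set_nonempty.1 I
  obtain ⟨z, hz, hz'⟩ : (interior (closure (V • ({x} : Set Y))) ∩ V • ({x} : Set Y)).Nonempty :=
    mem_closure_iff.1 (interior_subset hy) _ isOpen_interior hy
  obtain ⟨g', hg', rfl⟩ : ∃ g' ∈ V, g' • x = z := by simpa using hz'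
  have J : closure ((g'⁻¹ • V) • ({x} : Set Y)) ∈ 𝓝 x := by
    apply mem_interior_iff_mem_nhds.1
    rwa [smul_assoc, closure_smul, interior_smul, mem_inv_smul_set_iff]
  have : (g'⁻¹ • V) • {x} ⊆ U • ({x} : Set Y) := by
    apply smul_subset_smul_right
    apply Subset.trans (smul_set_subset_smul (inv_mem_inv.2 hg')) ?_
    rw [V_symm]
    exact VU
  exact Filter.mem_of_superset J (closure_mono this)

/-- The invariant of the back-and-forth construction. -/
def EffrosInv {G Y : Type*} [Group G] [MetricSpace G] [TopologicalSpace Y] [MulAction G Y]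
    (ε : ℝ) (a b : G) (x q : Y) : Prop :=
  ∃ U : Set G, (∀ f ∈ U, dist a (f * a) < ε) ∧ b • q ∈ closure (U • ({a • x} : Set Y))

theorem effros_substep {G Y : Type*} [Group G] [MetricSpace G]
    [IsTopologicalGroup G] [SecondCountableTopology G] [MetricSpace Y] [BaireSpace Y]
    [MulAction G Y] [ContinuousSMul G Y] [MulAction.IsPretransitive G Y]
    {ε ε' : ℝ} (hε' : 0 < ε') {a b : G} {x q : Y} (h : EffrosInv ε a b x q) :
    ∃ a' : G, dist a a' < ε ∧ dist (a' • x) (b • q) < ε' ∧ EffrosInv ε' b a' q x := by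
  obtain ⟨U, hU, hq⟩ := h
  have hc : Tendsto (fun f : G => f * b) (𝓝 1) (𝓝 b) := by
    have : Continuous (fun f : G => f * b) := by fun_prop
    simpa using this.tendsto 1
  have hU' : {f : G | dist b (f * b) < ε'} ∈ 𝓝 (1 : G) := by
    filter_upwards [hc (Metric.ball_mem_nhds b hε')] with f hf
    simpa [dist_comm] using hf
  have hn := effros_closure_mem_nhds hU' (b • q)
  obtain ⟨z, ⟨hz1, hz2⟩, hz⟩ := mem_closure_iff_nhds.1 hq _
    (inter_mem hn (Metric.ball_mem_nhds (b • q) hε'))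
  obtain ⟨f, hf, rfl⟩ : ∃ f ∈ U, f • (a • x) = z := by simpa using hz
  refine ⟨f * a, hU f hf, by simpa [mul_smul] using hz2,
    {f : G | dist b (f * b) < ε'}, fun f hf => hf, ?_⟩
  simpa only [mul_smul] using hz1

theorem effros_step {G Y : Type*} [Group G] [MetricSpace G]
    [IsTopologicalGroup G] [SecondCountableTopology G] [MetricSpace Y] [BaireSpace Y]
    [MulAction G Y] [ContinuousSMul G Y] [MulAction.IsPretransitive G Y]
    {ε ε' : ℝ} (hε : 0 < ε) (hε' : 0 < ε') {a b : G} {x q : Y} (h : EffrosInv ε a b x q) :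
    ∃ a' b' : G, dist a a' < ε ∧ dist b b' < ε ∧ dist (a' • x) (b' • q) < ε' ∧
      EffrosInv ε' a' b' x q := by
  obtain ⟨a', h1, -, h3⟩ := effros_substep hε h
  obtain ⟨b', h4, h5, h6⟩ := effros_substep hε' h3
  exact ⟨a', b', h1, h4, by rwa [dist_comm], h6⟩

/-- Effros theorem: orbit maps of transitive continuous actions of Polish groups are open. -/
theorem effros_mem_nhds {G Y : Type*} [Group G] [TopologicalSpace G]
    [IsTopologicalGroup G] [PolishSpace G] [MetricSpace Y] [BaireSpace Y]
    [MulAction G Y] [ContinuousSMul G Y] [MulAction.IsPretransitive G Y]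
    {U : Set G} (hU : U ∈ 𝓝 (1 : G)) (x : Y) : ∀ᶠ q in 𝓝 x, ∃ g ∈ U, g • x = q := by
  let := TopologicalSpace.upgradeIsCompletelyMetrizable G
  have hd : Tendsto (fun p : G × G => p.1⁻¹ * p.2) (𝓝 1 ×ˢ 𝓝 1) (𝓝 1) := by
    have : Continuous (fun p : G × G => p.1⁻¹ * p.2) := by fun_prop
    simpa [nhds_prod_eq] using this.tendsto (1, 1)
  obtain ⟨r, hr, hrU⟩ : ∃ r > 0, ∀ a b : G, dist 1 a ≤ r → dist 1 b ≤ r → a⁻¹ * b ∈ U := by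
    have h1 := hd hU
    rw [mem_map, mem_prod_self_iff] at h1
    obtain ⟨t, ht, htU⟩ := h1
    obtain ⟨r, hr, h⟩ := Metric.nhds_basis_closedBall.mem_iff.1 ht
    refine ⟨r, hr, fun a b ha hb => ?_⟩
    exact @htU (a, b) ⟨h (by simpa [dist_comm] using ha), h (by simpa [dist_comm] using hb)⟩
  let e : ℕ → ℝ := fun n => r / 2 / 2 ^ n
  have he : ∀ n, 0 < e n := fun n => by positivity
  have h0 : {f : G | dist 1 f < e 0} ∈ 𝓝 (1 : G) := by
    filter_upwards [Metric.ball_mem_nhds (1 : G) (he 0)] with f hf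
    simpa [dist_comm] using hf
  filter_upwards [effros_closure_mem_nhds h0 x] with q hq
  have hinit : EffrosInv (e 0) (1 : G) 1 x q :=
    ⟨{f : G | dist 1 f < e 0}, fun f hf => by simpa using hf, by simpa only [one_smul] using hq⟩
  have hstep : ∀ n (s : {s : G × G // EffrosInv (e n) s.1 s.2 x q}),
      ∃ s' : {s : G × G // EffrosInv (e (n + 1)) s.1 s.2 x q},
        dist s.1.1 s'.1.1 < e n ∧ dist s.1.2 s'.1.2 < e n ∧
          dist (s'.1.1 • x) (s'.1.2 • q) < e (n + 1) := by
    rintro n ⟨⟨a, b⟩, h⟩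
    obtain ⟨a', b', h1, h2, h3, h4⟩ := effros_step (he n) (he (n + 1)) h
    exact ⟨⟨(a', b'), h4⟩, h1, h2, h3⟩
  choose S hS using hstep
  let s : ∀ n, {s : G × G // EffrosInv (e n) s.1 s.2 x q} :=
    fun n => Nat.rec ⟨(1, 1), hinit⟩ S n
  have hA : ∀ n, dist (s n).1.1 (s (n + 1)).1.1 ≤ r / 2 / 2 ^ n := fun n => (hS n (s n)).1.le
  have hB : ∀ n, dist (s n).1.2 (s (n + 1)).1.2 ≤ r / 2 / 2 ^ n := fun n => (hS n (s n)).2.1.le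
  have hC : ∀ n, dist ((s (n + 1)).1.1 • x) ((s (n + 1)).1.2 • q) ≤ e (n + 1) :=
    fun n => (hS n (s n)).2.2.le
  obtain ⟨a, ha⟩ := cauchySeq_tendsto_of_complete (cauchySeq_of_le_geometric_two hA)
  obtain ⟨b, hb⟩ := cauchySeq_tendsto_of_complete (cauchySeq_of_le_geometric_two hB)
  have ha' : dist 1 a ≤ r := dist_le_of_le_geometric_two_of_tendsto₀ hA ha
  have hb' : dist 1 b ≤ r := dist_le_of_le_geometric_two_of_tendsto₀ hB hb
  have hlim : Tendsto e atTop (𝓝 0) := (summable_geometric_two' r).tendsto_atTop_zero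
  have heq : a • x = b • q := by
    have h1 : Tendsto (fun n => dist ((s (n + 1)).1.1 • x) ((s (n + 1)).1.2 • q)) atTop
        (𝓝 (dist (a • x) (b • q))) :=
      (((ha.comp (tendsto_add_atTop_nat 1)).smul_const x)).dist
        (((hb.comp (tendsto_add_atTop_nat 1)).smul_const q))
    have h2 := le_of_tendsto_of_tendsto' h1 (hlim.comp (tendsto_add_atTop_nat 1)) hC
    exact dist_le_zero.1 h2
  exact ⟨b⁻¹ * a, hrU b a hb' ha', by rw [mul_smul, heq, inv_smul_smul]⟩

/-! ### The homeomorphism group -/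

theorem polishSpace_of_locallyCompact (Y : Type*) [MetricSpace Y] [LocallyCompactSpace Y]
    [SecondCountableTopology Y] : PolishSpace Y := by
  let i : Y → UniformSpace.Completion Y := fun y => (y : UniformSpace.Completion Y)
  have hi : IsEmbedding i := UniformSpace.Completion.isUniformEmbedding_coe Y |>.isEmbedding
  have hdense : DenseRange i := UniformSpace.Completion.denseRange_coe
  have hopen : IsOpen (range i) := by
    rw [isOpen_iff_mem_nhds]
    rintro _ ⟨x, rfl⟩
    obtain ⟨N, hN, hx⟩ := exists_compact_mem_nhds x
    rw [hi.isInducing.nhds_eq_comap, mem_comap] at hx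
    obtain ⟨t, ht, htN⟩ := hx
    obtain ⟨O, hOt, hO, hxO⟩ := mem_nhds_iff.1 ht
    refine mem_nhds_iff.2 ⟨O, ?_, hO, hxO⟩
    have h1 : O ⊆ closure (O ∩ range i) := hdense.open_subset_closure_inter hO
    have h2 : O ∩ range i ⊆ i '' N := by
      rintro _ ⟨hy, y, rfl⟩
      exact ⟨y, htN (hOt hy), rfl⟩
    have h3 : IsClosed (i '' N) := (hN.image hi.continuous).isClosed
    exact h1.trans ((closure_minimal h2 h3).trans (image_subset_range _ _))
  have : PolishSpace (range i) := hopen.polishSpace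
  exact (hi.toHomeomorph.isClosedEmbedding).polishSpace

/-- Continuous self-maps, as a monoid under composition. -/
def CEnd (Y : Type*) [TopologicalSpace Y] := C(Y, Y)

instance (Y : Type*) [TopologicalSpace Y] : TopologicalSpace (CEnd Y) :=
  inferInstanceAs (TopologicalSpace C(Y, Y))

instance (Y : Type*) [TopologicalSpace Y] : Monoid (CEnd Y) where
  mul f g := ContinuousMap.comp f g
  one := ContinuousMap.id Y
  mul_assoc _ _ _ := rfl
  one_mul _ := rfl
  mul_one _ := rfl

instance (Y : Type*) [TopologicalSpace Y] [LocallyCompactSpace Y] : ContinuousMul (CEnd Y) where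
  continuous_mul := by
    have := (ContinuousMap.continuous_comp' (X := Y) (Y := Y) (Z := Y))
    exact this.comp continuous_swap

theorem cMap_polish (Y : Type*) [TopologicalSpace Y] [LocallyCompactSpace Y]
    [PolishSpace Y] : PolishSpace C(Y, Y) := by
  let := TopologicalSpace.upgradeIsCompletelyMetrizable Y
  have : SigmaCompactSpace Y := inferInstance
  have : CompleteSpace C(Y, Y) := inferInstance
  have : IsCompletelyMetrizableSpace C(Y, Y) := inferInstance
  infer_instance

theorem cEnd_polish (Y : Type*) [MetricSpace Y] [LocallyCompactSpace Y]
    [SecondCountableTopology Y] : PolishSpace (CEnd Y) := by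
  have := polishSpace_of_locallyCompact Y
  exact cMap_polish Y

instance (Y : Type*) [TopologicalSpace Y] : MulAction (CEnd Y)ˣ Y where
  smul f y := (show C(Y, Y) from f.1) y
  one_smul _ := rfl
  mul_smul _ _ _ := rfl

instance (Y : Type*) [TopologicalSpace Y] [LocallyCompactSpace Y] :
    ContinuousSMul (CEnd Y)ˣ Y where
  continuous_smul := by
    have h : Continuous (fun p : C(Y, Y) × Y => p.1 p.2) := ContinuousEval.continuous_eval
    exact h.comp (((Units.continuous_val (M := CEnd Y)).comp continuous_fst).prodMk continuous_snd)

/-- Units of the monoid of continuous self-maps from homeomorphisms. -/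
def unitOfHomeo {Y : Type*} [TopologicalSpace Y] (h : Y ≃ₜ Y) : (CEnd Y)ˣ where
  val := (⟨h, h.continuous⟩ : C(Y, Y))
  inv := (⟨h.symm, h.symm.continuous⟩ : C(Y, Y))
  val_inv := ContinuousMap.ext fun x => h.apply_symm_apply x
  inv_val := ContinuousMap.ext fun x => h.symm_apply_apply x

theorem effros_homeo {Y : Type*} [MetricSpace Y] [LocallyCompactSpace Y]
    [SecondCountableTopology Y] (hhom : IsHomogeneous Y) {K W : Set Y} (hK : IsCompact K)
    (hW : IsOpen W) (hKW : K ⊆ W) {L A : Set Y} (hL : IsCompact L) (hA : IsOpen A) (hLA : L ⊆ A)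
    (x : Y) :
    ∀ᶠ q in 𝓝 x, ∃ h : Y ≃ₜ Y, h x = q ∧ MapsTo h K W ∧ MapsTo h L A ∧
      MapsTo h.symm L A := by
  have : PolishSpace (CEnd Y) := cEnd_polish Y
  have : PolishSpace (CEnd Y)ᵐᵒᵖ := MulOpposite.opHomeomorph.symm.isClosedEmbedding.polishSpace
  have : PolishSpace (CEnd Y)ˣ := Units.isClosedEmbedding_embedProduct.polishSpace
  have : MulAction.IsPretransitive (CEnd Y)ˣ Y := ⟨fun a b => by
    obtain ⟨h, hh⟩ := hhom a b
    exact ⟨unitOfHomeo h, hh⟩⟩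
  have h0 : ∀ {K W : Set Y}, IsCompact K → IsOpen W → K ⊆ W →
      {f : (CEnd Y)ˣ | MapsTo (fun y => f • y) K W} ∈ 𝓝 (1 : (CEnd Y)ˣ) := by
    intro K W hK hW hKW
    have hO : IsOpen {f : C(Y, Y) | MapsTo f K W} := ContinuousMap.isOpen_setOfPred_mapsTo hK hW
    exact (hO.preimage (Units.continuous_val (M := CEnd Y))).mem_nhds (fun y hy => hKW hy)
  have h2 : {f : (CEnd Y)ˣ | MapsTo (fun y => f⁻¹ • y) L A} ∈ 𝓝 (1 : (CEnd Y)ˣ) := by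
    have : Tendsto (fun f : (CEnd Y)ˣ => f⁻¹) (𝓝 1) (𝓝 1) := by
      simpa using (continuous_inv (G := (CEnd Y)ˣ)).tendsto 1
    exact this (h0 hL hA hLA)
  filter_upwards [effros_mem_nhds (inter_mem (h0 hK hW hKW) (inter_mem (h0 hL hA hLA) h2)) x]
    with q ⟨g, hg, hgx⟩
  exact ⟨Homeomorph.smul g, hgx, hg.1, hg.2.1, hg.2.2⟩

/-! ### Saturated clopen sets -/

/-- The union of the quasi-components meeting `L`. -/
def qSat {Y : Type*} [TopologicalSpace Y] (L : Set Y) : Set Y :=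
  {x | ∃ y ∈ L, ∀ C : Set Y, IsClopen C → x ∈ C → y ∈ C}

theorem clopen_symm {Y : Type*} [TopologicalSpace Y] {x y : Y}
    (h : ∀ C : Set Y, IsClopen C → x ∈ C → y ∈ C) : ∀ C : Set Y, IsClopen C → y ∈ C → x ∈ C := by
  intro C hC hy
  by_contra hx
  exact h Cᶜ hC.compl hx hy

theorem exists_clopen_disjoint_of_isCompact {Y : Type*} [TopologicalSpace Y] {L : Set Y}
    (hL : IsCompact L) {x : Y} (hx : x ∉ qSat L) :
    ∃ C : Set Y, IsClopen C ∧ x ∈ C ∧ Disjoint C L := by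
  have h : ∀ y ∈ L, ∃ C : Set Y, IsClopen C ∧ x ∈ C ∧ y ∉ C := by
    intro y hy
    by_contra! hcon
    exact hx ⟨y, hy, hcon⟩
  refine hL.induction_on (p := fun L => ∃ C : Set Y, IsClopen C ∧ x ∈ C ∧ Disjoint C L)
    ⟨univ, isClopen_univ, mem_univ _, by simp⟩ ?_ ?_ ?_
  · rintro s t hst ⟨C, h1, h2, h3⟩
    exact ⟨C, h1, h2, h3.mono_right hst⟩
  · rintro s t ⟨C, h1, h2, h3⟩ ⟨D, h4, h5, h6⟩
    refine ⟨C ∩ D, h1.inter h4, ⟨h2, h5⟩, ?_⟩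
    rw [disjoint_union_right]
    exact ⟨h3.mono_left inter_subset_left, h6.mono_left inter_subset_right⟩
  · intro y hy
    obtain ⟨C, h1, h2, h3⟩ := h y hy
    exact ⟨Cᶜ, mem_nhdsWithin_of_mem_nhds (h1.compl.isOpen.mem_nhds h3), C, h1, h2,
      disjoint_compl_right⟩

theorem isClosed_qSat {Y : Type*} [TopologicalSpace Y] {L : Set Y} (hL : IsCompact L) :
    IsClosed (qSat L) := by
  rw [← isOpen_compl_iff, isOpen_iff_mem_nhds]
  intro x hx
  obtain ⟨C, h1, h2, h3⟩ := exists_clopen_disjoint_of_isCompact hL hx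
  filter_upwards [h1.isOpen.mem_nhds h2] with z hz
  rintro ⟨y, hy, h⟩
  exact h3.le_bot ⟨h C h1 hz, hy⟩

theorem isOpen_qSat {Y : Type*} [MetricSpace Y] [LocallyCompactSpace Y]
    [SecondCountableTopology Y] (hhom : IsHomogeneous Y) {V : Set Y} (hV : IsOpen V) :
    IsOpen (qSat V) := by
  rw [isOpen_iff_mem_nhds]
  rintro x ⟨y, hy, h⟩
  filter_upwards [effros_homeo hhom (isCompact_singleton (x := y)) hV
    (singleton_subset_iff.2 hy) isCompact_empty isOpen_empty Subset.rfl x] with q ⟨f, hf, hf1, _⟩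
  refine ⟨f y, hf1 (mem_singleton y), fun C hC hq => ?_⟩
  exact h (f ⁻¹' C) (hC.preimage f.continuous) (by simpa [hf] using hq)

theorem exists_small_clopen {Y : Type*} [MetricSpace Y] [LocallyCompactSpace Y]
    [SecondCountableTopology Y] (hhom : IsHomogeneous Y) {K B : Set Y} (hK : IsCompact K)
    (hB : IsClopen B) (hKB : K ⊆ B) :
    ∃ A L : Set Y, IsClopen A ∧ K ⊆ L ∧ L ⊆ A ∧ A ⊆ B ∧ IsCompact L ∧ A ⊆ qSat L := by
  obtain ⟨L, hL, hKL⟩ := exists_compact_superset hK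
  set U := qSat (interior L) with hU
  have hUo : IsOpen U := isOpen_qSat hhom isOpen_interior
  have hUsat : ∀ {x y : Y}, (∀ C : Set Y, IsClopen C → x ∈ C → y ∈ C) → x ∈ U → y ∈ U := by
    rintro x y h ⟨z, hz, h'⟩
    exact ⟨z, hz, fun C hC hy => h' C hC (clopen_symm h C hC hy)⟩
  have hself : ∀ {S : Set Y}, S ⊆ qSat S := fun {S} x hx => ⟨x, hx, fun _ _ h => h⟩
  have hLU : IsCompact (L \ U) := hL.diff hUo
  -- separate `K` from `L \ U`
  obtain ⟨C, hC, hKC, hCd⟩ : ∃ C : Set Y, IsClopen C ∧ K ⊆ C ∧ Disjoint C (L \ U) := by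
    refine hK.induction_on (p := fun K => ∃ C : Set Y, IsClopen C ∧ K ⊆ C ∧ Disjoint C (L \ U))
      ⟨∅, isClopen_empty, by simp, by simp⟩ ?_ ?_ ?_
    · rintro s t hst ⟨C, h1, h2, h3⟩
      exact ⟨C, h1, hst.trans h2, h3⟩
    · rintro s t ⟨C, h1, h2, h3⟩ ⟨D, h4, h5, h6⟩
      exact ⟨C ∪ D, h1.union h4, union_subset_union h2 h5, disjoint_union_left.2 ⟨h3, h6⟩⟩
    · intro x hx
      have hxn : x ∉ qSat (L \ U) := by
        rintro ⟨y, hy, h⟩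
        exact hy.2 (hUsat h (hself (hKL hx)))
      obtain ⟨C, h1, h2, h3⟩ := exists_clopen_disjoint_of_isCompact hLU hxn
      exact ⟨C, mem_nhdsWithin_of_mem_nhds (h1.isOpen.mem_nhds h2), C, h1, Subset.rfl, h3⟩
  have hCU : C ∩ U = C ∩ qSat L := by
    apply Subset.antisymm
    · rintro x ⟨hx, y, hy, h⟩
      exact ⟨hx, y, interior_subset hy, h⟩
    · rintro x ⟨hx, y, hy, h⟩
      refine ⟨hx, ?_⟩
      by_contra hxU
      have hyU : y ∉ U := fun hyU => hxU (hUsat (clopen_symm h) hyU)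
      exact hCd.le_bot ⟨h C hC hx, hy, hyU⟩
  have hA : IsClopen (C ∩ U) := by
    refine ⟨?_, hC.isOpen.inter hUo⟩
    rw [hCU]
    exact hC.isClosed.inter (isClosed_qSat hL)
  have hA' : IsClopen ((C ∩ U) ∩ B) := hA.inter hB
  refine ⟨(C ∩ U) ∩ B, L ∩ ((C ∩ U) ∩ B), hA', ?_, inter_subset_right, inter_subset_right,
    hL.inter_right hA'.isClosed, ?_⟩
  · intro x hx
    exact ⟨interior_subset (hKL hx), ⟨hKC hx, hself (hKL hx)⟩, hKB hx⟩
  · intro x hx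
    have : x ∈ C ∩ qSat L := hCU ▸ hx.1
    obtain ⟨-, y, hy, h⟩ := this
    exact ⟨y, ⟨hy, h _ hA' hx⟩, h⟩

/-- Restrict a homeomorphism to an invariant clopen set, extended by the identity. -/
theorem exists_homeo_restrict {Y : Type*} [TopologicalSpace Y] {A : Set Y} (hA : IsClopen A)
    (h : Y ≃ₜ Y) (h1 : MapsTo h A A) (h2 : MapsTo h.symm A A) :
    ∃ g : Y ≃ₜ Y, (∀ x ∈ A, g x = h x) ∧ ∀ x ∉ A, g x = x := by
  classical
  have hc : ∀ f : Y → Y, Continuous f → Continuous (fun x => if x ∈ A then f x else x) := by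
    intro f hf
    refine Continuous.if ?_ hf continuous_id
    intro a ha
    have : a ∈ frontier A := ha
    simp [hA.frontier_eq] at this
  refine ⟨{ toFun := fun x => if x ∈ A then h x else x
            invFun := fun x => if x ∈ A then h.symm x else x
            left_inv := ?_
            right_inv := ?_
            continuous_toFun := hc _ h.continuous
            continuous_invFun := hc _ h.symm.continuous }, ?_, ?_⟩
  · intro x
    by_cases hx : x ∈ A
    · simp [hx, h1 hx]
    · simp [hx]
  · intro x
    by_cases hx : x ∈ A
    · simp [hx, h2 hx]
    · simp [hx]
  · intro x hx
    simp [hx]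
  · intro x hx
    simp [hx]

theorem effros_supported {Y : Type*} [MetricSpace Y] [LocallyCompactSpace Y]
    [SecondCountableTopology Y] (hhom : IsHomogeneous Y) {K W B : Set Y} (hK : IsCompact K)
    (hW : IsOpen W) (hKW : K ⊆ W) (hB : IsClopen B) (hKB : K ⊆ B) {p : Y} (hp : p ∈ K) :
    ∀ᶠ q in 𝓝 p, ∃ h : Y ≃ₜ Y, h p = q ∧ MapsTo h K W ∧ ∀ y ∉ B, h y = y := by
  obtain ⟨A, L, hA, hKL, hLA, hAB, hL, hAL⟩ := exists_small_clopen hhom hK hB hKB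
  filter_upwards [effros_homeo hhom hK hW hKW hL hA.isOpen hLA p] with q ⟨h, h1, h2, h3, h4⟩
  have key : ∀ f : Y ≃ₜ Y, MapsTo f L A → MapsTo f A A := by
    intro f hf x hx
    obtain ⟨y, hy, hxy⟩ := hAL hx
    exact clopen_symm hxy (f ⁻¹' A) (hA.preimage f.continuous) (hf hy)
  obtain ⟨g, hg1, hg2⟩ := exists_homeo_restrict hA h (key h h3) (key h.symm h4)
  have hKA : K ⊆ A := hKL.trans hLA
  refine ⟨g, by rw [hg1 p (hKA hp), h1], fun x hx => ?_, fun y hy => hg2 y fun h => hy (hAB h)⟩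
  rw [hg1 x (hKA hx)]
  exact h2 hx

theorem effros_supported_metrizable {Y : Type*} [TopologicalSpace Y] [MetrizableSpace Y]
    [LocallyCompactSpace Y] [SecondCountableTopology Y] (hhom : IsHomogeneous Y) {K W B : Set Y}
    (hK : IsCompact K) (hW : IsOpen W) (hKW : K ⊆ W) (hB : IsClopen B) (hKB : K ⊆ B) {p : Y}
    (hp : p ∈ K) :
    ∀ᶠ q in 𝓝 p, ∃ h : Y ≃ₜ Y, h p = q ∧ MapsTo h K W ∧ ∀ y ∉ B, h y = y := by
  let := TopologicalSpace.metrizableSpaceMetric Y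
  exact effros_supported hhom hK hW hKW hB hKB hp

/-! ### Reduction to the separable case -/

theorem exists_sigmaCompact_clopen {X : Type*} [MetricSpace X] [LocallyCompactSpace X]
    {K : Set X} (hK : IsCompact K) :
    ∃ S : Set X, IsClopen S ∧ K ⊆ S ∧ IsSigmaCompact S := by
  have h := fun x : X => exists_compact_mem_nhds x
  choose N hN hxN using h
  obtain ⟨v, hvo, hvc, hvf, hvN⟩ := precise_refinement (fun x => interior (N x))
    (fun x => isOpen_interior)
    (iUnion_eq_univ_iff.2 fun x => ⟨x, mem_interior_iff_mem_nhds.2 (hxN x)⟩)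
  let step : Set X → Set X := fun T => ⋃ i ∈ {i | (v i ∩ T).Nonempty}, closure (v i)
  let T : ℕ → Set X := fun n => step^[n] K
  have hTs : ∀ n, T (n + 1) = step (T n) := fun n => Function.iterate_succ_apply' step n K
  have hTc : ∀ n, IsCompact (T n) := by
    intro n
    induction n with
    | zero => exact hK
    | succ n ih =>
      rw [hTs]
      refine (hvf.finite_nonempty_inter_compact ih).isCompact_biUnion fun i _ => ?_
      exact (hN i).of_isClosed_subset isClosed_closure
        (closure_minimal ((hvN i).trans interior_subset) (hN i).isClosed)
  have hv : ∀ i n, (v i ∩ T n).Nonempty → v i ⊆ ⋃ n, T n := by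
    intro i n hi x hx
    refine mem_iUnion.2 ⟨n + 1, ?_⟩
    rw [hTs]
    exact mem_biUnion (show i ∈ {i | (v i ∩ T n).Nonempty} from hi) (subset_closure hx)
  have hcov : ∀ x, ∃ i, x ∈ v i := fun x => iUnion_eq_univ_iff.1 hvc x
  refine ⟨⋃ n, T n, ⟨?_, ?_⟩, fun x hx => mem_iUnion.2 ⟨0, hx⟩, T, hTc, rfl⟩
  · rw [← isOpen_compl_iff, isOpen_iff_mem_nhds]
    intro x hx
    obtain ⟨i, hi⟩ := hcov x
    filter_upwards [(hvo i).mem_nhds hi] with z hz hzT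
    obtain ⟨n, hn⟩ := mem_iUnion.1 hzT
    exact hx (hv i n ⟨z, hz, hn⟩ hi)
  · rw [isOpen_iff_mem_nhds]
    intro x hx
    obtain ⟨i, hi⟩ := hcov x
    obtain ⟨n, hn⟩ := mem_iUnion.1 hx
    exact mem_of_superset ((hvo i).mem_nhds hi) (hv i n ⟨x, hi, hn⟩)

/-- The partial homeomorphism induced by `h` on a clopen set, made into a global
homeomorphism of the double. -/
theorem exists_double_homeo {X : Type*} [TopologicalSpace X] {S : Set X} (hS : IsClopen S)
    (h : X ≃ₜ X) (x y : S) (hxy : h x = y) :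
    ∃ g : (S × Bool) ≃ₜ (S × Bool), g (x, false) = (y, true) := by
  classical
  -- a continuous extension of the partial map by a default
  let φ : (X ≃ₜ X) → Bool → S × Bool → S × Bool := fun f b z =>
    if hz : f z.1 ∈ S then (⟨f z.1, hz⟩, !b) else (z.1, b)
  let s : S × Bool → S × Bool := fun z =>
    if z.2 = true then φ h.symm true z else φ h false z
  have hφ : ∀ f b, Continuous (φ f b) := by
    intro f b
    have hcl : IsClopen {z : S × Bool | f z.1 ∈ S} :=
      hS.preimage (f.continuous.comp (continuous_subtype_val.comp continuous_fst))
    have hfr : frontier {z : S × Bool | f z.1 ∈ S} = ∅ := hcl.frontier_eq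
    have e1 : ∀ z, ((φ f b z).1 : X) = if f z.1 ∈ S then f z.1 else z.1 := by
      intro z
      by_cases hz : f z.1 ∈ S <;> simp [φ, hz]
    have e2 : ∀ z, (φ f b z).2 = if f z.1 ∈ S then !b else b := by
      intro z
      by_cases hz : f z.1 ∈ S <;> simp [φ, hz]
    refine Continuous.prodMk (f := fun z => (φ f b z).1) (g := fun z => (φ f b z).2) ?_ ?_
    · refine continuous_induced_rng.2 ?_
      refine (Continuous.if (p := fun z : S × Bool => f z.1 ∈ S) (f := fun z => f z.1)
        (g := fun z => (z.1 : X)) ?_ (by fun_prop) (by fun_prop)).congr (fun z => (e1 z).symm)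
      intro a ha
      rw [hfr] at ha
      exact ha.elim
    · refine (Continuous.if (p := fun z : S × Bool => f z.1 ∈ S) (f := fun z => !b)
        (g := fun z => b) ?_ (by fun_prop) (by fun_prop)).congr (fun z => (e2 z).symm)
      intro a ha
      rw [hfr] at ha
      exact ha.elim
  have hs : Continuous s := by
    refine Continuous.if ?_ (hφ _ _) (hφ _ _)
    intro a ha
    have hcl : IsClopen {z : S × Bool | z.2 = true} :=
      (isClopen_discrete {true}).preimage continuous_snd
    rw [hcl.frontier_eq] at ha
    exact ha.elim
  have hinv : ∀ z, s (s z) = z := by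
    rintro ⟨z, b⟩
    cases b
    · by_cases hz : h z ∈ S <;> simp [s, φ, hz]
    · by_cases hz : h.symm z ∈ S <;> simp [s, φ, hz]
  refine ⟨{ toFun := s, invFun := s, left_inv := hinv, right_inv := hinv,
            continuous_toFun := hs, continuous_invFun := hs }, ?_⟩
  have : h x ∈ S := hxy ▸ y.2
  simp [s, φ, hxy]

theorem isHomogeneous_double {X : Type*} [TopologicalSpace X] (hhom : IsHomogeneous X)
    {S : Set X} (hS : IsClopen S) : IsHomogeneous (S × Bool) := by
  have h1 : ∀ x y : S, ∃ g : (S × Bool) ≃ₜ (S × Bool), g (x, false) = (y, true) := by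
    intro x y
    obtain ⟨h, hh⟩ := hhom x y
    exact exists_double_homeo hS h x y hh
  have h2 : ∀ x : S, ∀ z : S × Bool, ∃ g : (S × Bool) ≃ₜ (S × Bool), g (x, false) = z := by
    rintro x ⟨y, b⟩
    cases b
    · obtain ⟨g, hg⟩ := h1 x x
      obtain ⟨g', hg'⟩ := h1 y x
      exact ⟨g.trans g'.symm, by simp [hg, ← hg']⟩
    · exact h1 x y
  intro z w
  obtain ⟨g, hg⟩ := h2 z.1 z
  obtain ⟨g', hg'⟩ := h2 z.1 w
  exact ⟨g.symm.trans g', by rw [← hg, ← hg']; simp⟩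

/-- Transfer a homeomorphism of the double supported on the first copy to `X`. -/
theorem exists_homeo_transfer {X : Type*} [TopologicalSpace X] {S : Set X} (hS : IsClopen S)
    (p : S) (h : (S × Bool) ≃ₜ (S × Bool)) (hh : ∀ z : S × Bool, z.2 = true → h z = z) :
    ∃ g : X ≃ₜ X, ∀ x : S, g x = (h (x, false)).1 := by
  classical
  let r : X → S := fun x => if hx : x ∈ S then ⟨x, hx⟩ else p
  have hif : ∀ f g : X → X, Continuous f → Continuous g →
      Continuous (fun x => if x ∈ S then f x else g x) := by
    intro f g hf hg
    refine Continuous.if ?_ hf hg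
    intro a ha
    have : a ∈ frontier S := ha
    simp [hS.frontier_eq] at this
  have hr : Continuous r := by
    refine continuous_induced_rng.2 ((hif id (fun _ => p) continuous_id continuous_const).congr ?_)
    intro x
    by_cases hx : x ∈ S <;> simp [r, hx]
  have hrS : ∀ x : S, r x = x := fun x => by simp [r]
  let F : ((S × Bool) ≃ₜ (S × Bool)) → X → X := fun k x =>
    if x ∈ S then ((k (r x, false)).1 : X) else x
  have hF : ∀ k, Continuous (F k) := fun k => hif _ _ (by fun_prop) continuous_id
  have hFS : ∀ k, ∀ x : S, F k x = (k (x, false)).1 := fun k x => by simp [F, hrS]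
  have hFn : ∀ k, ∀ x ∉ S, F k x = x := fun k x hx => by simp [F, hx]
  have hinv : ∀ k : (S × Bool) ≃ₜ (S × Bool), (∀ z : S × Bool, z.2 = true → k z = z) →
      ∀ x, F k.symm (F k x) = x := by
    intro k hk x
    by_cases hx : x ∈ S
    · lift x to S using hx
      rw [hFS, hFS]
      have h2 : (k (x, false)).2 = false := by
        by_contra hne
        have h3 : (k (x, false)).2 = true := by simpa using hne
        have h4 := k.injective (hk _ h3)
        rw [h4] at h3
        simp at h3
      have : ((k (x, false)).1, false) = k (x, false) := Prod.ext rfl h2.symm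
      rw [this]
      simp
    · rw [hFn k x hx, hFn _ x hx]
  have hh' : ∀ z : S × Bool, z.2 = true → h.symm z = z := fun z hz => by
    rw [Homeomorph.symm_apply_eq, hh z hz]
  exact ⟨{ toFun := F h, invFun := F h.symm, left_inv := hinv h hh, right_inv := hinv h.symm hh',
           continuous_toFun := hF h, continuous_invFun := hF h.symm }, hFS h⟩

theorem exists_homeomorph_moving_point_keeping_compact_in_open
    {X : Type*} [MetricSpace X] [LocallyCompactSpace X]
    (hhom : IsHomogeneous X) (K : Set X) (hK : IsCompact K)
    (W : Set X) (hW : IsOpen W) (hKW : K ⊆ W) (p : X) (hp : p ∈ K) :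
    ∃ δ > 0, ∀ q : X, dist p q < δ →
      ∃ h : X ≃ₜ X, h p = q ∧ h '' K ⊆ W := by
  obtain ⟨S, hS, hKS, hSσ⟩ := exists_sigmaCompact_clopen hK
  have : LocallyCompactSpace S := hS.isOpen.locallyCompactSpace
  have : SigmaCompactSpace S := isSigmaCompact_iff_sigmaCompactSpace.1 hSσ
  have : SecondCountableTopology S := EMetric.secondCountable_of_sigmaCompact S
  let i : S → S × Bool := fun x => (x, false)
  have hi : Continuous i := by fun_prop
  let π : S × Bool → X := fun z => z.1
  have hπ : Continuous π := by fun_prop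
  have hK' : IsCompact (i '' (Subtype.val ⁻¹' K : Set S)) :=
    (hS.isClosed.isClosedEmbedding_subtypeVal.isCompact_preimage hK).image hi
  have hB : IsClopen {z : S × Bool | z.2 = false} :=
    (isClopen_discrete {false}).preimage continuous_snd
  have hev := effros_supported_metrizable (isHomogeneous_double hhom hS) hK' (hW.preimage hπ)
    (by rintro _ ⟨x, hx, rfl⟩; exact hKW hx) hB (by rintro _ ⟨x, hx, rfl⟩; rfl)
    (p := i ⟨p, hKS hp⟩) ⟨⟨p, hKS hp⟩, hp, rfl⟩
  have hev2 := hi.continuousAt.eventually hev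
  rw [hS.isOpen.isOpenEmbedding_subtypeVal.isInducing.nhds_eq_comap, eventually_comap] at hev2
  obtain ⟨δ, hδ, H⟩ := Metric.eventually_nhds_iff.1 (hev2.and (hS.isOpen.mem_nhds (hKS hp)))
  refine ⟨δ, hδ, fun q hq => ?_⟩
  rw [dist_comm] at hq
  obtain ⟨h1, hqS⟩ := H hq
  obtain ⟨h, hh1, hh2, hh3⟩ := h1 ⟨q, hqS⟩ rfl
  obtain ⟨g, hg⟩ := exists_homeo_transfer hS ⟨p, hKS hp⟩ h (fun z hz => hh3 z (by simp [hz]))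
  refine ⟨g, ?_, ?_⟩
  · have := hg ⟨p, hKS hp⟩
    rw [show h (⟨p, hKS hp⟩, false) = i ⟨q, hqS⟩ from hh1] at this
    exact this
  · rintro _ ⟨x, hx, rfl⟩
    rw [hg ⟨x, hKS hx⟩]
    exact hh2 ⟨⟨x, hKS hx⟩, hx, rfl⟩
end
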